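/- Let G = (V, E, ε) be a loopless multigraph and D a strongly connected orientation of G with in-degree function ρ_D. Then D is a decreasingly minimal strongly connected orientation of G (i.e., ρ_D ≤_dec ρ_{D′} for every strongly connected orientation D′ of G) if and only if there exist no vertices s, t ∈ V with ρ_D(t) ≥ ρ_D(s) + 2 such that D contains two arc-disjoint directed paths from s to t. -/

import Mathlib

open Finset

/-- An orientation of a multigraph `(V, E, ε)`: each edge `e` gets a tail and a
head whose unordered pair is `ε e`. -/
structure GraphOrientation (V : Type*) (E : Type*) (ε : E → Sym2 V) where
  tail : E → V
  head : E → V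
  compat : ∀ e : E, ε e = s(tail e, head e)

/-- The in-degree (as an integer) of a vertex in an orientation. -/
def indeg {V E : Type*} [Fintype E] [DecidableEq V] {ε : E → Sym2 V}
    (D : GraphOrientation V E ε) (v : V) : ℤ :=
  ((Finset.univ.filter (fun e => D.head e = v)).card : ℤ)

/-- `Reach D s t`: `t` is reachable from `s` in the orientation `D`. -/
def Reach {V E : Type*} {ε : E → Sym2 V} (D : GraphOrientation V E ε) : V → V → Prop :=
  Relation.ReflTransGen (fun u v => ∃ e : E, D.tail e = u ∧ D.head e = v)

/-- `x↓`: the values of `x` arranged in nonincreasing order. -/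
def sortedDesc {V : Type*} [Fintype V] (x : V → ℤ) : List ℤ :=
  ((Finset.univ.val.map x).sort (· ≤ ·)).reverse

/-- `x ≤_dec y`: `x↓` is lexicographically less than or equal to `y↓`. -/
def DecLE {V : Type*} [Fintype V] (x y : V → ℤ) : Prop :=
  sortedDesc x = sortedDesc y ∨ List.Lex (· < ·) (sortedDesc x) (sortedDesc y)

/-- A directed path in `D` from `s` to `t`: a nonempty list of pairwise distinct
edges whose first edge starts at `s`, last edge ends at `t`, and consecutive edges
are head-to-tail. -/
def IsDipath {V E : Type*} {ε : E → Sym2 V}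
    (D : GraphOrientation V E ε) (s t : V) (l : List E) : Prop :=
  l ≠ [] ∧ l.Nodup ∧
    (∀ e ∈ l.head?, D.tail e = s) ∧
    (∀ e ∈ l.getLast?, D.head e = t) ∧
    l.Chain' (fun e f => D.head e = D.tail f)

section Abstract

variable {V : Type*} [Fintype V] [DecidableEq V]

lemma cover_sum (P : Finset V → Prop) (z : V → ℤ)
    (hU : ∀ A B, P A → P B → (A ∩ B).Nonempty → P (A ∪ B))
    (hz : ∀ A, P A → 0 ≤ ∑ v ∈ A, z v) :
    ∀ (n : ℕ) (Z : Finset V), Z.card ≤ n →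
      (∀ t ∈ Z, ∃ A, P A ∧ t ∈ A ∧ A ⊆ Z) → 0 ≤ ∑ v ∈ Z, z v := by
  classical
  intro n
  induction n with
  | zero =>
    intro Z hZ _
    have : Z = ∅ := by simpa using hZ
    simp [this]
  | succ n ih =>
    intro Z hZ hc
    rcases Z.eq_empty_or_nonempty with rfl | ⟨t, ht⟩
    · simp
    obtain ⟨A0, hA0, htA0, hA0Z⟩ := hc t ht
    let S := Z.powerset.filter (fun A => P A ∧ t ∈ A)
    have hS : S.Nonempty := ⟨A0, by simp [S, hA0, htA0, hA0Z]⟩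
    obtain ⟨A, hAS, hmax⟩ := S.exists_max_image Finset.card hS
    simp only [S, mem_filter, mem_powerset] at hAS hmax
    obtain ⟨hAZ, hPA, htA⟩ := hAS
    have h1 : 0 ≤ ∑ v ∈ Z \ A, z v := by
      apply ih
      · have : (Z \ A).card < Z.card := by
          apply Finset.card_lt_card
          refine ⟨sdiff_subset, fun h => ?_⟩
          have := h ht
          simp [htA] at this
        omega
      · intro u hu
        simp only [mem_sdiff] at hu
        obtain ⟨B, hB, huB, hBZ⟩ := hc u hu.1
        refine ⟨B, hB, huB, fun w hw => ?_⟩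
        simp only [mem_sdiff]
        refine ⟨hBZ hw, fun hwA => ?_⟩
        have h2 := hmax (A ∪ B) ⟨union_subset hAZ hBZ,
          hU A B hPA hB ⟨w, by simp [hw, hwA]⟩, by simp [htA]⟩
        have h3 : A.card < (A ∪ B).card := by
          apply Finset.card_lt_card
          refine ⟨subset_union_left, fun h => hu.2 (h (by simp [huB]))⟩
        omega
    have h2 := hz A hPA
    have h3 := Finset.sum_sdiff (f := z) hAZ
    linarith

lemma good_sum (C : Finset V → Prop) (z : V → ℤ)
    (hC : ∀ X Y, C X → C Y → (X ∩ Y).Nonempty → X ∪ Y ≠ univ → C (X ∩ Y) ∧ C (X ∪ Y))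
    (hz : ∀ X, C X → 0 ≤ ∑ v ∈ X, z v) (hz0 : ∑ v, z v = 0)
    (Z : Finset V) (hZ : ∀ t ∈ Z, ∀ u, u ∉ Z → ∃ X, C X ∧ t ∈ X ∧ u ∉ X) :
    0 ≤ ∑ v ∈ Z, z v := by
  classical
  refine cover_sum (fun Y => Y.Nonempty ∧ ∀ w, w ∉ Y → ∃ X, C X ∧ Y ⊆ X ∧ w ∉ X) z
    ?_ ?_ _ Z le_rfl ?_
  · rintro A B ⟨⟨a, ha⟩, hA⟩ ⟨-, hB⟩ hAB
    refine ⟨⟨a, by simp [ha]⟩, fun w hw => ?_⟩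
    simp only [mem_union, not_or] at hw
    obtain ⟨X, hX, hAX, hwX⟩ := hA w hw.1
    obtain ⟨Y, hY, hBY, hwY⟩ := hB w hw.2
    refine ⟨X ∪ Y, (hC X Y hX hY (hAB.mono (inter_subset_inter hAX hBY)) ?_).2,
      union_subset_union hAX hBY, by simp [hwX, hwY]⟩
    intro h
    have : w ∈ X ∪ Y := h ▸ mem_univ w
    simp [hwX, hwY] at this
  · rintro Y ⟨⟨t, ht⟩, hY⟩
    have h1 : 0 ≤ ∑ v ∈ Yᶜ, (- z v) := by
      refine cover_sum (fun W => C Wᶜ ∧ t ∉ W) (fun v => - z v) ?_ ?_ _ Yᶜ le_rfl ?_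
      · rintro A B ⟨hA, htA⟩ ⟨hB, htB⟩ ⟨w, hw⟩
        refine ⟨?_, by simp [htA, htB]⟩
        rw [compl_union]
        refine (hC _ _ hA hB ⟨t, by simp [htA, htB]⟩ ?_).1
        intro h
        have : w ∈ Aᶜ ∪ Bᶜ := h ▸ mem_univ w
        simp only [mem_inter, mem_union, mem_compl] at hw this
        tauto
      · rintro A ⟨hA, -⟩
        have := hz _ hA
        have h3 := Finset.sum_add_sum_compl A z
        rw [Finset.sum_neg_distrib]
        linarith
      · intro w hw
        obtain ⟨X, hX, hYX, hwX⟩ := hY w (by simpa using hw)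
        exact ⟨Xᶜ, ⟨by simpa using hX, by simpa using hYX ht⟩, by simpa using hwX,
          compl_subset_compl.2 hYX⟩
    have h3 := Finset.sum_add_sum_compl Y z
    rw [Finset.sum_neg_distrib] at h1
    linarith
  · intro t ht
    refine ⟨univ.filter (fun v => ∀ X, C X → t ∈ X → v ∈ X), ⟨⟨t, ?_⟩, ?_⟩, ?_, ?_⟩
    · simp
    · intro w hw
      simp only [mem_filter, mem_univ, true_and, not_forall] at hw
      obtain ⟨X, hX, htX, hwX⟩ := hw
      refine ⟨X, hX, fun v hv => ?_, hwX⟩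
      simp only [mem_filter, mem_univ, true_and] at hv
      exact hv X hX htX
    · simp
    · intro v hv
      simp only [mem_filter, mem_univ, true_and] at hv
      by_contra hvZ
      obtain ⟨X, hX, htX, hvX⟩ := hZ t ht v hvZ
      exact hvX (hv X hX htX)

end Abstract

section Order

def pp (k a : ℤ) : ℤ := max (a - k) 0

lemma list_lex : ∀ (a b : List ℤ), a.length = b.length →
    a.Pairwise (fun x y => y ≤ x) → b.Pairwise (fun x y => y ≤ x) →
    (∀ k, (a.map (pp k)).sum ≤ (b.map (pp k)).sum) →
    a = b ∨ List.Lex (· < ·) a b := by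
  intro a
  induction a with
  | nil =>
    intro b hl _ _ _
    left
    symm
    simpa using hl.symm
  | cons a0 a ih =>
    intro b hl ha hb hk
    cases b with
    | nil => simp at hl
    | cons b0 b =>
      rcases lt_trichotomy a0 b0 with h | h | h
      · right; exact List.Lex.rel h
      · subst h
        rcases ih b (by simpa using hl) ha.of_cons hb.of_cons
          (fun k => by simpa using hk k) with h | h
        · left; rw [h]
        · right; exact List.Lex.cons h
      · exfalso
        have h1 := hk b0
        have h2 : (b.map (pp b0)).sum = 0 := by
          apply List.sum_eq_zero
          intro x hx
          obtain ⟨y, hy, rfl⟩ := List.mem_map.1 hx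
          have := List.rel_of_pairwise_cons hb hy
          simp only [pp]
          omega
        have h3 : 0 ≤ (a.map (pp b0)).sum := by
          apply List.sum_nonneg
          intro x hx
          obtain ⟨y, hy, rfl⟩ := List.mem_map.1 hx
          simp [pp]
        simp only [List.map_cons, List.sum_cons, h2] at h1
        simp only [pp] at h1 h3
        omega

variable {V : Type*} [Fintype V]

lemma sortedDesc_sum (x : V → ℤ) (k : ℤ) :
    ((sortedDesc x).map (pp k)).sum = ∑ v, pp k (x v) := by
  unfold sortedDesc
  rw [List.map_reverse, List.sum_reverse, ← Multiset.sum_coe, ← Multiset.map_coe,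
    Multiset.sort_eq, Multiset.map_map]
  rfl

lemma sortedDesc_length (x : V → ℤ) : (sortedDesc x).length = Fintype.card V := by
  simp [sortedDesc]

lemma sortedDesc_pairwise (x : V → ℤ) : (sortedDesc x).Pairwise (fun x y => y ≤ x) := by
  unfold sortedDesc
  rw [List.pairwise_reverse]
  exact Multiset.pairwise_sort _ _

lemma decLE_of_pp (x y : V → ℤ) (h : ∀ k, ∑ v, pp k (x v) ≤ ∑ v, pp k (y v)) :
    DecLE x y := by
  apply list_lex _ _ _ (sortedDesc_pairwise x) (sortedDesc_pairwise y)
  · intro k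
    simpa [sortedDesc_sum] using h k
  · simp [sortedDesc_length]

lemma lex_asymm : ∀ (a b : List ℤ), List.Lex (· < ·) a b → List.Lex (· < ·) b a → False := by
  intro a b h
  induction h with
  | nil => intro h; cases h
  | cons _ ih =>
    intro h
    cases h with
    | cons h => exact ih h
    | rel h => exact lt_irrefl _ h
  | rel h =>
    intro h'
    cases h' with
    | cons h' => exact lt_irrefl _ h
    | rel h' => exact lt_asymm h h'

lemma not_decLE_of_pp (x y : V → ℤ) (h : ∀ k, ∑ v, pp k (y v) ≤ ∑ v, pp k (x v))
    (k : ℤ) (hk : ∑ v, pp k (y v) < ∑ v, pp k (x v)) : ¬ DecLE x y := by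
  have hne : sortedDesc x ≠ sortedDesc y := by
    intro he
    have h1 := sortedDesc_sum x k
    have h2 := sortedDesc_sum y k
    rw [he] at h1
    omega
  rintro (h1 | h1)
  · exact hne h1
  · rcases decLE_of_pp y x h with h2 | h2
    · exact hne h2.symm
    · exact lex_asymm _ _ h1 h2

end Order

section Graph

variable {V E : Type*} [Fintype V] [Fintype E] [DecidableEq V] [DecidableEq E] {ε : E → Sym2 V}

/-- number of arcs entering `X` -/
def din (D : GraphOrientation V E ε) (X : Finset V) : ℤ :=
  ∑ e : E, if D.head e ∈ X ∧ D.tail e ∉ X then 1 else 0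

/-- net out-flow of the edge `e` at `v` -/
def netE (D : GraphOrientation V E ε) (v : V) (e : E) : ℤ :=
  (if D.tail e = v then 1 else 0) - (if D.head e = v then 1 else 0)

def flipO (D : GraphOrientation V E ε) (F : Finset E) : GraphOrientation V E ε where
  tail e := if e ∈ F then D.head e else D.tail e
  head e := if e ∈ F then D.tail e else D.head e
  compat e := by
    by_cases h : e ∈ F
    · simp only [h, if_true]; rw [D.compat e, Sym2.eq_swap]
    · simp only [h, if_false]; exact D.compat e

lemma indeg_eq (D : GraphOrientation V E ε) (v : V) :
    indeg D v = ∑ e : E, if D.head e = v then 1 else 0 := by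
  simp [indeg]

lemma sum_indeg (D : GraphOrientation V E ε) (X : Finset V) :
    ∑ v ∈ X, indeg D v = (∑ e : E, if (∀ v ∈ ε e, v ∈ X) then 1 else 0) + din D X := by
  simp only [indeg_eq, din]
  rw [Finset.sum_comm, ← Finset.sum_add_distrib]
  refine Finset.sum_congr rfl fun e _ => ?_
  rw [D.compat e]
  simp only [Sym2.mem_iff, forall_eq_or_imp, forall_eq, Finset.sum_ite_eq]
  by_cases h1 : D.head e ∈ X <;> by_cases h2 : D.tail e ∈ X <;> simp [h1, h2]

lemma indeg_flip (D : GraphOrientation V E ε) (F : Finset E) (v : V) :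
    indeg (flipO D F) v = indeg D v + ∑ e ∈ F, netE D v e := by
  simp only [indeg_eq]
  rw [← Finset.sum_ite_mem_eq F, ← Finset.sum_add_distrib]
  refine Finset.sum_congr rfl fun e _ => ?_
  by_cases h : e ∈ F <;> simp [flipO, netE, h]

lemma din_nonneg (D : GraphOrientation V E ε) (X : Finset V) : 0 ≤ din D X :=
  Finset.sum_nonneg fun e _ => by split_ifs <;> simp

lemma din_pos_iff (D : GraphOrientation V E ε) (X : Finset V) :
    1 ≤ din D X ↔ ∃ e, D.head e ∈ X ∧ D.tail e ∉ X := by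
  constructor
  · intro h
    by_contra hc
    push Not at hc
    have : din D X = 0 := Finset.sum_eq_zero fun e _ => by
      rw [if_neg]
      rintro ⟨h1, h2⟩
      exact h2 (hc e h1)
    omega
  · rintro ⟨e, he⟩
    have := Finset.single_le_sum (f := fun e => if D.head e ∈ X ∧ D.tail e ∉ X then (1 : ℤ) else 0)
      (s := univ) (fun e _ => by split_ifs <;> simp) (mem_univ e)
    simpa [he, din] using this

lemma din_two (D : GraphOrientation V E ε) (X : Finset V) (e f : E) (hef : e ≠ f)
    (he : D.head e ∈ X ∧ D.tail e ∉ X) (hf : D.head f ∈ X ∧ D.tail f ∉ X) :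
    2 ≤ din D X := by
  have := Finset.sum_le_sum_of_subset_of_nonneg
    (f := fun e => if D.head e ∈ X ∧ D.tail e ∉ X then (1 : ℤ) else 0)
    (subset_univ {e, f}) (fun e _ _ => by split_ifs <;> simp)
  rw [Finset.sum_pair hef] at this
  simpa [he, hf, din] using this

lemma din_super (D : GraphOrientation V E ε) (X Y : Finset V) :
    din D (X ∩ Y) + din D (X ∪ Y) ≤ din D X + din D Y := by
  simp only [din]
  rw [← Finset.sum_add_distrib, ← Finset.sum_add_distrib]
  refine Finset.sum_le_sum fun e _ => ?_
  simp only [mem_inter, mem_union]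
  by_cases h1 : D.head e ∈ X <;> by_cases h2 : D.tail e ∈ X <;>
  by_cases h3 : D.head e ∈ Y <;> by_cases h4 : D.tail e ∈ Y <;> simp [h1, h2, h3, h4]

/-- Reachability through cuts. -/
lemma reach_of_cut (D : GraphOrientation V E ε) (F : Finset E) (s t : V)
    (h : ∀ X : Finset V, t ∈ X → s ∉ X → ∃ e ∈ F, D.head e ∈ X ∧ D.tail e ∉ X) :
    Relation.ReflTransGen (fun u v => ∃ e ∈ F, D.tail e = u ∧ D.head e = v) s t := by
  classical
  by_contra hc
  obtain ⟨e, heF, h1, h2⟩ := h (univ.filter fun v =>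
    ¬ Relation.ReflTransGen (fun u v => ∃ e ∈ F, D.tail e = u ∧ D.head e = v) s v)
    (by simpa using hc) (by simpa using Relation.ReflTransGen.refl)
  simp only [mem_filter, mem_univ, true_and, not_not] at h1 h2
  exact h1 (h2.tail ⟨e, heF, rfl, rfl⟩)

lemma cut_of_reach (D : GraphOrientation V E ε) (s t : V) (h : Reach D s t)
    (X : Finset V) (ht : t ∈ X) (hs : s ∉ X) : 1 ≤ din D X := by
  rw [din_pos_iff]
  by_contra hc
  push Not at hc
  have : t ∉ X := by
    clear ht
    induction h with
    | refl => exact hs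
    | tail _ hbc ih =>
      obtain ⟨e, rfl, rfl⟩ := hbc
      intro hx
      exact ih (hc e hx)
  exact this ht

lemma strong_of_din (D : GraphOrientation V E ε)
    (h : ∀ X : Finset V, X.Nonempty → X ≠ univ → 1 ≤ din D X) (u v : V) : Reach D u v := by
  have := reach_of_cut D univ u v (fun X hv hu => by
    obtain ⟨e, he⟩ := (din_pos_iff D X).1 (h X ⟨v, hv⟩ (fun hX => hu (hX ▸ mem_univ u)))
    exact ⟨e, mem_univ e, he⟩)
  simpa [Reach] using this

lemma din_of_strong (D : GraphOrientation V E ε) (hD : ∀ u v, Reach D u v)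
    (X : Finset V) (hX : X.Nonempty) (hX' : X ≠ univ) : 1 ≤ din D X := by
  obtain ⟨t, ht⟩ := hX
  obtain ⟨s, hs⟩ : ∃ s, s ∉ X := by
    by_contra hc
    push Not at hc
    exact hX' (eq_univ_iff_forall.2 hc)
  exact cut_of_reach D s t (hD s t) X ht hs

lemma dipath_net (D : GraphOrientation V E ε) (v t : V) : ∀ (l : List E) (s : V), IsDipath D s t l →
    (l.map (netE D v)).sum = (if s = v then 1 else 0) - (if t = v then 1 else 0) := by
  intro l
  induction l with
  | nil => intro s h; exact absurd rfl h.1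
  | cons e l ih =>
    intro s h
    obtain ⟨-, hnd, hh, hl, hch⟩ := h
    have hs : D.tail e = s := hh e (by simp)
    cases l with
    | nil =>
      have ht : D.head e = t := hl e (by simp)
      simp [netE, hs, ht]
    | cons f l =>
      have := ih (D.tail f) ⟨by simp, hnd.of_cons, by simp, by simpa using hl, hch.tail⟩
      rw [List.map_cons, List.sum_cons, this]
      have h2 : D.head e = D.tail f := (List.isChain_cons_cons.1 hch).1
      simp [netE, hs, h2]

/-- `F` is a `k`-flow from `s` to `t`. -/
def IsFlow (D : GraphOrientation V E ε) (s t : V) (k : ℤ) (F : Finset E) : Prop :=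
  ∀ v, ∑ e ∈ F, netE D v e = k * ((if s = v then 1 else 0) - (if t = v then 1 else 0))

lemma dipath_flow (D : GraphOrientation V E ε) (s t : V) (l : List E) (h : IsDipath D s t l) :
    IsFlow D s t 1 l.toFinset := by
  intro v
  rw [List.sum_toFinset _ h.2.1, dipath_net D v t l s h, one_mul]

lemma flow_cut_sum (D : GraphOrientation V E ε) (s t : V) (k : ℤ) (F : Finset E)
    (h : IsFlow D s t k F) (X : Finset V) :
    ∑ v ∈ X, ∑ e ∈ F, netE D v e = k * ((if s ∈ X then 1 else 0) - (if t ∈ X then 1 else 0)) := by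
  rw [Finset.sum_congr rfl (fun v _ => h v), ← Finset.mul_sum, Finset.sum_sub_distrib]
  simp

lemma flow_cut (D : GraphOrientation V E ε) (s t : V) (k : ℤ) (hk : 0 < k) (F : Finset E)
    (h : IsFlow D s t k F) (X : Finset V) (ht : t ∈ X) (hs : s ∉ X) :
    ∃ e ∈ F, D.head e ∈ X ∧ D.tail e ∉ X := by
  have h1 := flow_cut_sum D s t k F h X
  simp only [hs, ht, if_true, if_false] at h1
  rw [Finset.sum_comm] at h1
  by_contra hc
  push Not at hc
  have : 0 ≤ ∑ e ∈ F, ∑ v ∈ X, netE D v e := by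
    refine Finset.sum_nonneg fun e he => ?_
    have := hc e he
    simp only [netE, Finset.sum_sub_distrib, Finset.sum_ite_eq]
    by_cases hx : D.head e ∈ X
    · simp [hx, this hx]
    · simp only [hx, if_false]; split_ifs <;> simp
  linarith

lemma dipath_of_reach (D : GraphOrientation V E ε) (F : Finset E) (s t : V)
    (h : Relation.ReflTransGen (fun u v => ∃ e ∈ F, D.tail e = u ∧ D.head e = v) s t) :
    s = t ∨ ∃ l, IsDipath D s t l ∧ l.toFinset ⊆ F := by
  induction h using Relation.ReflTransGen.head_induction_on with
  | refl => left; rfl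
  | head hab _ ih =>
    right
    obtain ⟨e, heF, rfl, rfl⟩ := hab
    rcases ih with ih | ⟨l, ⟨hne, hnd, hh, hl, hch⟩, hlF⟩
    · exact ⟨[e], ⟨by simp, by simp, by simp, by simpa using ih, List.isChain_singleton e⟩, by simpa using heF⟩
    · by_cases he : e ∈ l
      · obtain ⟨a, b, rfl⟩ := List.append_of_mem he
        refine ⟨e :: b, ⟨by simp, hnd.of_append_right, by simp, ?_, ?_⟩, ?_⟩
        · intro f hf
          apply hl f
          simpa [List.getLast?_append] using hf
        · exact (List.isChain_append.1 hch).2.1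
        · intro f hf
          apply hlF
          simp only [List.mem_toFinset, List.mem_append] at hf ⊢
          exact Or.inr hf
      · refine ⟨e :: l, ⟨by simp, by simp [he, hnd], by simp, ?_, ?_⟩, ?_⟩
        · cases l with
          | nil => exact absurd rfl hne
          | cons f l => simpa using hl
        · cases l with
          | nil => exact absurd rfl hne
          | cons f l =>
            refine List.isChain_cons_cons.2 ⟨?_, hch⟩
            exact (hh f (by simp)).symm
        · intro f hf
          simp only [List.mem_toFinset, List.mem_cons] at hf
          rcases hf with rfl | hf
          · exact heF
          · exact hlF (by simpa using hf)

lemma dipath_of_flow (D : GraphOrientation V E ε) (s t : V) (hst : s ≠ t) (k : ℤ) (hk : 0 < k)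
    (F : Finset E) (h : IsFlow D s t k F) : ∃ l, IsDipath D s t l ∧ l.toFinset ⊆ F := by
  rcases dipath_of_reach D F s t (reach_of_cut D F s t (flow_cut D s t k hk F h)) with h | h
  · exact absurd h hst
  · exact h

lemma flow_symmDiff (D : GraphOrientation V E ε) (P Q : Finset E) (v : V) :
    ∑ e ∈ symmDiff P Q, netE D v e = ∑ e ∈ P, netE D v e + ∑ e ∈ Q, netE (flipO D P) v e := by
  rw [← Finset.sum_ite_mem_eq (symmDiff P Q), ← Finset.sum_ite_mem_eq P,
    ← Finset.sum_ite_mem_eq Q, ← Finset.sum_add_distrib]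
  refine Finset.sum_congr rfl fun e _ => ?_
  by_cases h : e ∈ P <;> by_cases h' : e ∈ Q <;> simp [flipO, netE, h, h', mem_symmDiff]

lemma din_flip (D : GraphOrientation V E ε) (s t : V) (P : Finset E) (h : IsFlow D s t 1 P)
    (X : Finset V) :
    din (flipO D P) X = din D X + ((if s ∈ X then 1 else 0) - (if t ∈ X then 1 else 0)) := by
  have h1 := sum_indeg D X
  have h2 := sum_indeg (flipO D P) X
  simp only [indeg_flip] at h2
  rw [Finset.sum_add_distrib, flow_cut_sum D s t 1 P h X] at h2
  linarith

lemma menger (D : GraphOrientation V E ε) (hD : ∀ u v, Reach D u v) (s t : V) (hst : s ≠ t)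
    (hno : ¬ ∃ l₁ l₂ : List E, IsDipath D s t l₁ ∧ IsDipath D s t l₂ ∧ l₁.Disjoint l₂) :
    ∃ X : Finset V, din D X = 1 ∧ t ∈ X ∧ s ∉ X := by
  by_contra hc
  push Not at hc
  obtain ⟨p, hp, -⟩ : ∃ l, IsDipath D s t l ∧ l.toFinset ⊆ univ := by
    have h : Relation.ReflTransGen (fun u v => ∃ e ∈ (univ : Finset E),
      D.tail e = u ∧ D.head e = v) s t := by simpa [Reach] using hD s t
    rcases dipath_of_reach D univ s t h with h | h
    · exact absurd h hst
    · exact h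
  have hP := dipath_flow D s t p hp
  set P := p.toFinset
  have hcut : ∀ X : Finset V, t ∈ X → s ∉ X →
      ∃ e ∈ (univ : Finset E), (flipO D P).head e ∈ X ∧ (flipO D P).tail e ∉ X := by
    intro X ht hs
    have h1 : 1 ≤ din (flipO D P) X := by
      rw [din_flip D s t P hP X]
      have h2 := cut_of_reach D s t (hD s t) X ht hs
      have h3 : din D X ≠ 1 := fun h => hs (hc X h ht)
      simp only [hs, ht, if_true, if_false]
      omega
    obtain ⟨e, he⟩ := (din_pos_iff _ X).1 h1
    exact ⟨e, mem_univ e, he⟩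
  obtain ⟨q, hq, -⟩ := (dipath_of_reach (flipO D P) univ s t
    (reach_of_cut _ _ _ _ hcut)).resolve_left hst
  have hQ := dipath_flow _ s t q hq
  set Q := q.toFinset
  have hF : IsFlow D s t 2 (symmDiff P Q) := by
    intro v
    rw [flow_symmDiff, hP v, hQ v]
    ring
  obtain ⟨l₁, hl₁, hs₁⟩ := dipath_of_flow D s t hst 2 (by norm_num) _ hF
  have hF' : IsFlow D s t 1 (symmDiff P Q \ l₁.toFinset) := by
    intro v
    have h1 := Finset.sum_sdiff (f := netE D v) hs₁
    rw [hF v, dipath_flow D s t l₁ hl₁ v] at h1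
    linarith
  obtain ⟨l₂, hl₂, hs₂⟩ := dipath_of_flow D s t hst 1 (by norm_num) _ hF'
  refine hno ⟨l₁, l₂, hl₁, hl₂, fun e h1 h2 => ?_⟩
  have := hs₂ (List.mem_toFinset.2 h2)
  simp only [mem_sdiff, List.mem_toFinset] at this
  exact this.2 h1

end Graph

/-- A strongly connected orientation of a loopless multigraph is a decreasingly
minimal strongly connected orientation iff there are no nodes `s, t` with
`ρ(t) ≥ ρ(s) + 2` joined by two arc-disjoint `s → t` dipaths. -/
theorem stmt19 {V E : Type*} [Fintype V] [Fintype E] [DecidableEq V] [DecidableEq E]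
    (ε : E → Sym2 V) (hloopless : ∀ e : E, ¬ (ε e).IsDiag)
    (D : GraphOrientation V E ε) (hD : ∀ u v : V, Reach D u v) :
    (∀ D' : GraphOrientation V E ε, (∀ u v : V, Reach D' u v) →
        DecLE (indeg D) (indeg D')) ↔
      ¬ ∃ (s t : V) (l₁ l₂ : List E),
        IsDipath D s t l₁ ∧ IsDipath D s t l₂ ∧ l₁.Disjoint l₂ ∧
        indeg D s + 2 ≤ indeg D t := by
  classical
  constructor
  · rintro hmin ⟨s, t, l₁, l₂, h₁, h₂, hdis, hst⟩
    have hne : s ≠ t := by rintro rfl; omega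
    have hf₁ := dipath_flow D s t l₁ h₁
    have hf₂ := dipath_flow D s t l₂ h₂
    have hdec := hmin (flipO D l₁.toFinset) (strong_of_din _ fun X hX hX' => by
      rw [din_flip D s t _ hf₁ X]
      have h0 := din_of_strong D hD X hX hX'
      by_cases hs : s ∈ X
      · simp only [hs, if_true]; split_ifs <;> omega
      by_cases ht : t ∈ X
      · obtain ⟨e, he, he'⟩ := flow_cut D s t 1 one_pos _ hf₁ X ht hs
        obtain ⟨f, hf, hf'⟩ := flow_cut D s t 1 one_pos _ hf₂ X ht hs
        have := din_two D X e f (by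
          rintro rfl
          exact hdis (List.mem_toFinset.1 he) (List.mem_toFinset.1 hf)) he' hf'
        simp only [hs, ht, if_true, if_false]; omega
      · simp only [hs, ht, if_false]; omega)
    have hx : ∀ v, indeg (flipO D l₁.toFinset) v =
        indeg D v + ((if s = v then 1 else 0) - (if t = v then 1 else 0)) := by
      intro v
      rw [indeg_flip, hf₁ v, one_mul]
    have key : ∀ k, ∑ v, pp k (indeg (flipO D l₁.toFinset) v) = ∑ v, pp k (indeg D v) +
        ((pp k (indeg D s + 1) - pp k (indeg D s)) + (pp k (indeg D t - 1) - pp k (indeg D t))) := by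
      intro k
      have : ∀ v, pp k (indeg (flipO D l₁.toFinset) v) = pp k (indeg D v) +
          ((if s = v then pp k (indeg D s + 1) - pp k (indeg D s) else 0) +
          (if t = v then pp k (indeg D t - 1) - pp k (indeg D t) else 0)) := by
        intro v
        rw [hx v]
        by_cases h1 : s = v
        · subst h1
          simp [hne.symm]
        · by_cases h2 : t = v
          · subst h2
            simp [hne, sub_eq_add_neg]
          · simp [h1, h2]
      rw [Finset.sum_congr rfl (fun v _ => this v), Finset.sum_add_distrib,
        Finset.sum_add_distrib]
      simp
    refine not_decLE_of_pp _ _ ?_ (indeg D t - 1) ?_ hdec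
    · intro k
      rw [key k]
      simp only [pp]
      omega
    · rw [key]
      simp only [pp]
      omega
  · intro hno D' hD'
    apply decLE_of_pp
    intro k
    let C : Finset V → Prop := fun X => din D X = 1
    have hCne : ∀ X, C X → X.Nonempty ∧ X ≠ univ := by
      intro X hX
      obtain ⟨e, h1, h2⟩ := (din_pos_iff D X).1 (le_of_eq hX.symm)
      exact ⟨⟨_, h1⟩, fun h => h2 (h ▸ mem_univ _)⟩
    let Z : Finset V := univ.filter fun v => ∃ t, k < indeg D t ∧ ∀ X, C X → t ∈ X → v ∈ X
    have hZ : 0 ≤ ∑ v ∈ Z, (indeg D' v - indeg D v) := by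
      apply good_sum C
      · intro X Y hX hY hI hU
        have h1 := din_super D X Y
        have h2 := din_of_strong D hD (X ∩ Y) hI (fun h => (hCne X hX).2 (by
          rw [← univ_subset_iff, ← h]; exact inter_subset_left))
        have h3 := din_of_strong D hD (X ∪ Y) ((hCne X hX).1.mono subset_union_left) hU
        simp only [C] at hX hY ⊢
        omega
      · intro X hX
        rw [Finset.sum_sub_distrib, sum_indeg, sum_indeg]
        have h1 := din_of_strong D' hD' X (hCne X hX).1 (hCne X hX).2
        simp only [C] at hX
        omega
      · rw [Finset.sum_sub_distrib, sum_indeg, sum_indeg]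
        simp [din]
      · intro t' ht' u hu
        simp only [Z, mem_filter, mem_univ, true_and] at ht' hu
        obtain ⟨t, ht, htX⟩ := ht'
        push Not at hu
        obtain ⟨X, hX, h1, h2⟩ := hu t ht
        exact ⟨X, hX, htX X hX h1, h2⟩
    have hZge : ∀ v ∈ Z, k ≤ indeg D v := by
      intro v hv
      simp only [Z, mem_filter, mem_univ, true_and] at hv
      obtain ⟨t, ht, htX⟩ := hv
      by_contra hlt
      push Not at hlt
      obtain ⟨X, hX, h1, h2⟩ := menger D hD v t (by rintro rfl; omega) (by
        rintro ⟨l₁, l₂, h1, h2, h3⟩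
        exact hno ⟨v, t, l₁, l₂, h1, h2, h3, by omega⟩)
      exact h2 (htX X hX h1)
    have hnZ : ∀ v, v ∉ Z → indeg D v ≤ k := by
      intro v hv
      by_contra hlt
      push Not at hlt
      apply hv
      simp only [Z, mem_filter, mem_univ, true_and]
      exact ⟨v, hlt, fun X _ h => h⟩
    have e1 : ∑ v, pp k (indeg D v) = ∑ v ∈ Z, (indeg D v - k) := by
      rw [← Finset.sum_ite_mem_eq Z]
      refine Finset.sum_congr rfl fun v _ => ?_
      by_cases hv : v ∈ Z
      · have := hZge v hv
        simp only [hv, if_true, pp]; omega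
      · have := hnZ v hv
        simp only [hv, if_false, pp]; omega
    have e2 : ∑ v ∈ Z, (indeg D' v - k) ≤ ∑ v, pp k (indeg D' v) := by
      rw [← Finset.sum_ite_mem_eq Z]
      refine Finset.sum_le_sum fun v _ => ?_
      by_cases hv : v ∈ Z
      · simp only [hv, if_true, pp]; omega
      · simp only [hv, if_false, pp]; omega
    have e3 : ∑ v ∈ Z, (indeg D' v - indeg D v) =
        ∑ v ∈ Z, (indeg D' v - k) - ∑ v ∈ Z, (indeg D v - k) := by
      rw [← Finset.sum_sub_distrib]
      refine Finset.sum_congr rfl fun v _ => ?_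
      ring
    linarith
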